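/- Let κ be an uncountable cardinal, and let (P₁, L₁) and (P₂, L₂) be projective planes, each admitting a well-founded HF-order, such that #P₁ + #L₁ = κ = #P₂ + #L₂. Then the two planes are isomorphic: there exist bijections f : P₁ ≃ P₂ and g : L₁ ≃ L₂ such that for every point p ∈ P₁ and every line ℓ ∈ L₁, p is incident with ℓ if and only if f(p) is incident with g(ℓ). (Theorem 5.28 / Corollary 5.29: the class of projective planes admitting a well-founded HF-construction is uncountably categorical.) -/

import Mathlib

open Cardinal

universe u

/-- Incidence between elements of the disjoint union of the points and the lines of an
incidence structure: a point and a line are incident when the point lies on the line. -/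
def HFIncid {P L : Type u} [Membership P L] : P ⊕ L → P ⊕ L → Prop
  | Sum.inl p, Sum.inr l => p ∈ l
  | Sum.inr l, Sum.inl p => p ∈ l
  | _, _ => False

/-- A well-founded HF-order on an incidence structure: a well-order on the disjoint union of
points and lines in which every element is incident with at most two elements strictly
preceding it. -/
def HasWFHFOrder (P L : Type u) [Membership P L] : Prop :=
  ∃ r : (P ⊕ L) → (P ⊕ L) → Prop, IsWellOrder (P ⊕ L) r ∧
    ∀ x : P ⊕ L, ∃ a b : P ⊕ L, ∀ y : P ⊕ L, r y x → HFIncid y x → y = a ∨ y = b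

namespace HFP

/-- abstract plane on a single sort; `s x` says that `x` is a point -/
structure Pl {E : Type u} (I : E → E → Prop) (s : E → Prop) : Prop where
  symm : ∀ x y, I x y → I y x
  sort : ∀ x y, I x y → (s x ↔ ¬ s y)
  join : ∀ x y, x ≠ y → (s x ↔ s y) → ∃ z, I x z ∧ I y z
  uniq : ∀ x y a b, I x a → I y a → I x b → I y b → x = y ∨ a = b
  off : ∀ l l', ¬ s l → ¬ s l' → ∃ p, s p ∧ ¬ I p l ∧ ¬ I p l'
  line : ∃ l, ¬ s l
  thr : ∀ p, s p → ∃ l, ¬ s l ∧ I p l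

/-- `y` is incident with `x` and of lower rank -/
def O {E : Type u} (I : E → E → Prop) (r : E → ℕ) (x y : E) : Prop := I x y ∧ r y < r x

structure HF {E : Type u} (I : E → E → Prop) (r : E → ℕ) : Prop where
  ne : ∀ x y, I x y → r x ≠ r y
  two : ∀ x a b c, O I r x a → O I r x b → O I r x c → a = b ∨ a = c ∨ b = c

structure Frame {E : Type u} (I : E → E → Prop) (s : E → Prop) (l m0 m1 m2 n0 n1 n2 : E) :
    Prop where
  sl : ¬ s l
  sm0 : s m0
  sm1 : s m1
  sm2 : s m2
  sn0 : ¬ s n0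
  sn1 : ¬ s n1
  sn2 : ¬ s n2
  ml0 : ¬ I m0 l
  ml1 : ¬ I m1 l
  ml2 : ¬ I m2 l
  i01 : I m0 n1
  i02 : I m0 n2
  i10 : I m1 n0
  i12 : I m1 n2
  i20 : I m2 n0
  i21 : I m2 n1
  j0 : ¬ I m0 n0
  j1 : ¬ I m1 n1
  j2 : ¬ I m2 n2

structure St {E : Type u} (I : E → E → Prop) (r : E → ℕ) (l m0 m1 m2 n0 n1 n2 : E) :
    Prop where
  hf : HF I r
  rl : r l = 0
  rm0 : r m0 = 1
  rm1 : r m1 = 1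
  rm2 : r m2 = 1
  rn0 : r n0 = 2
  rn1 : r n1 = 2
  rn2 : r n2 = 2
  low : ∀ z, r z < 3 → z = l ∨ z = m0 ∨ z = m1 ∨ z = m2 ∨ z = n0 ∨ z = n1 ∨ z = n2

variable {E : Type u} {I : E → E → Prop} {s : E → Prop}


theorem step_core (h : Pl I s) {r key : E → ℕ} (hr : HF I r) {l m0 m1 m2 l1 : E} {M : ℕ}
    {J : E → Prop}
    (sl : ¬ s l) (sm : ∀ z, z = m0 ∨ z = m1 ∨ z = m2 → s z) 
    (ml : ∀ z, z = m0 ∨ z = m1 ∨ z = m2 → ¬ I z l)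
    (i0 : I m0 l1) (i1 : I m1 l1) (m21 : ¬ I m2 l1)
    (lineJ : ∀ z, ¬ s z → z ≠ l → J z → M = r m2)
    (ptJ : ∀ z, s z → M = r m2 → J z → I z l ∨ I z l1 ∨ z = m2)
    (khigh : ∀ z, ¬ J z → key z = r z + 7 ∧ M ≤ r z)
    (klow : ∀ z, J z → key z < 7 ∧ r z ≤ M)
    (lc : ∀ z, ¬ s z → J z → (z = l ∧ key z = 0) ∨ (z ≠ l ∧ z = l1 ∧ key z = 2) ∨
      (z ≠ l ∧ z ≠ l1 ∧ I m2 z ∧ key z = 4) ∨ (z ≠ l ∧ z ≠ l1 ∧ ¬ I m2 z ∧ key z = 6))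
    (pc : ∀ z, s z → J z → ((z = m0 ∨ z = m1 ∨ z = m2) ∧ key z = 1) ∨
      (¬ (z = m0 ∨ z = m1 ∨ z = m2) ∧ I z l1 ∧ key z = 3) ∨
      (¬ (z = m0 ∨ z = m1 ∨ z = m2) ∧ ¬ I z l1 ∧ key z = 5)) : HF I key := by
  have hso := h.sort
  have hsy := h.symm
  refine ⟨?_, ?_⟩
  · intro x y hxy
    have h1 := hso x y hxy
    have h2 := hr.ne x y hxy
    by_cases hx : J x <;> by_cases hy : J y
    · by_cases hs : s x
      · have := pc x hs hx
        have := lc y (by tauto) hy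
        omega
      · have := lc x hs hx
        have := pc y (by tauto) hy
        omega
    · have := klow x hx; have := khigh y hy; omega
    · have := klow y hy; have := khigh x hx; omega
    · have := khigh y hy; have := khigh x hx; omega
  · intro x a b c ha hb hc
    by_cases hx : J x
    · have hJ : ∀ y, O I key x y → J y := by
        intro y hy
        by_contra hh
        have := khigh y hh; have := klow x hx; have := hy.2; omega
      have ja := hJ a ha
      have jb := hJ b hb
      have jc := hJ c hc
      obtain ⟨ia, ka⟩ := ha
      obtain ⟨ib, kb⟩ := hb
      obtain ⟨ic, kc⟩ := hc
      have sa := hso _ _ ia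
      have sb := hso _ _ ib
      have sc := hso _ _ ic
      have fin2 : ∀ u v : E, (∀ y, I x y → key y < key x → J y → y = u ∨ y = v) →
          a = b ∨ a = c ∨ b = c := by
        intro u v hh
        have h1 := hh a ia ka ja
        have h2 := hh b ib kb jb
        have h3 := hh c ic kc jc
        clear * - h1 h2 h3
        grind
      have finQ : ∀ Q R : E → Prop, (∀ y z, I x y → I x z → Q y → Q z → y = z) →
          (∀ y z, I x y → I x z → R y → R z → y = z) →
          (∀ y, I x y → key y < key x → J y → Q y ∨ R y) → a = b ∨ a = c ∨ b = c := by
        intro Q R hQ hR hh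
        have h1 := hh a ia ka ja
        have h2 := hh b ib kb jb
        have h3 := hh c ic kc jc
        clear * - h1 h2 h3 hQ hR ia ib ic
        grind
      have onl : ∀ k, x ≠ k → ∀ y z, I x y → I x z → I y k → I z k → y = z := by
        intro k hk y z h1 h2 h3 h4
        have := h.uniq y z x k (hsy _ _ h1) (hsy _ _ h2) h3 h4
        tauto
      by_cases hs : s x
      · have hns : ∀ y, I x y → ¬ s y := by
          intro y hy; have := hso _ _ hy; tauto
        rcases pc x hs hx with ⟨hm, k⟩ | ⟨hm, hx1, k⟩ | ⟨hm, hx1, k⟩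
        · refine fin2 l l ?_
          intro y h1 h2 h3
          rcases lc y (hns y h1) h3 with ⟨h4, -⟩ | h4 | h4 | h4
          · exact .inl h4
          all_goals omega
        · refine fin2 l l1 ?_
          intro y h1 h2 h3
          rcases lc y (hns y h1) h3 with ⟨h4, -⟩ | h4 | h4 | h4
          · exact .inl h4
          · exact .inr h4.2.1
          all_goals omega
        · by_cases hMm : M = r m2
          · refine finQ (fun y => y = l) (fun y => I m2 y) ?_ ?_ ?_
            · intro y z _ _ h1 h2; rw [h1, h2]
            · intro y z h1 h2 h3 h4
              exact onl m2 (by tauto) y z h1 h2 (hsy _ _ h3) (hsy _ _ h4)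
            · intro y h1 h2 h3
              rcases lc y (hns y h1) h3 with ⟨h4, -⟩ | h4 | h4 | h4
              · exact .inl h4
              · exact absurd (h4.2.1 ▸ h1) hx1
              · exact .inr h4.2.2.1
              · omega
          · refine fin2 l l ?_
            intro y h1 h2 h3
            by_contra hyl
            exact hMm (lineJ y (hns y h1) (by tauto) h3)
      · have hps : ∀ y, I x y → s y := by
          intro y hy; have := hso _ _ hy; tauto
        rcases lc x hs hx with ⟨h4, k⟩ | ⟨hxl, hx1, k⟩ | ⟨hxl, hx1, hx2, k⟩ | ⟨hxl, hx1, hx2, k⟩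
        · omega
        · refine fin2 m0 m1 ?_
          intro y h1 h2 h3
          rcases pc y (hps y h1) h3 with ⟨h4, -⟩ | h4 | h4
          · rcases h4 with h4 | h4 | h4
            · exact .inl h4
            · exact .inr h4
            · exact absurd (hsy _ _ (hx1 ▸ h4 ▸ h1)) m21
          all_goals omega
        · refine finQ (fun y => y = m2) (fun y => I y l1) ?_ (onl _ hx1) ?_
          · intro y z _ _ h1 h2; rw [h1, h2]
          · intro y h1 h2 h3
            rcases pc y (hps y h1) h3 with ⟨h4, -⟩ | h4 | h4
            · rcases h4 with h4 | h4 | h4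
              · exact .inr (h4 ▸ i0)
              · exact .inr (h4 ▸ i1)
              · exact .inl h4
            · exact .inr h4.2.1
            · omega
        · have hMm := lineJ x hs hxl hx
          refine finQ (fun y => I y l) (fun y => I y l1) (onl _ hxl) (onl _ hx1) ?_
          intro y h1 h2 h3
          rcases ptJ y (hps y h1) hMm h3 with h4 | h4 | h4
          · exact .inl h4
          · exact .inr h4
          · exact absurd (hsy _ _ (h4 ▸ h1)) hx2
    · have hlow : ∀ y, O I key x y → O I r x y := by
        intro y hy
        refine ⟨hy.1, ?_⟩
        have h1 := hy.2
        have h2 := khigh x hx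
        have h3 := hr.ne _ _ hy.1
        by_cases hyJ : J y
        · have := klow y hyJ
          omega
        · have := khigh y hyJ; omega
      exact hr.two x a b c (hlow a ha) (hlow b hb) (hlow c hc)

/-- the first reordering -/
theorem step_one (h : Pl I s) {r : E → ℕ} (hr : HF I r) : ∃ (r' : E → ℕ) (l m0 m1 m2 l1 : E),
    HF I r' ∧ ¬ s l ∧ s m0 ∧ s m1 ∧ s m2 ∧ ¬ I m0 l ∧ ¬ I m1 l ∧ ¬ I m2 l ∧ m0 ≠ m1 ∧
    I m0 l1 ∧ I m1 l1 ∧ ¬ I m2 l1 ∧ r' l = 0 ∧ r' m0 = 1 ∧ r' m1 = 1 ∧ r' m2 = 1 ∧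
    ∀ z, r' z < 2 → z = l ∨ z = m0 ∨ z = m1 ∨ z = m2 := by
  classical
  have mini : ∀ Q : E → Prop, (∃ x, Q x) → ∃ x, Q x ∧ ∀ y, Q y → r x ≤ r y := by
    intro Q ⟨x, hx⟩
    obtain ⟨y, hy, hy2⟩ := (measure r).wf.has_min {x | Q x} ⟨x, hx⟩
    exact ⟨y, hy, fun z hz => not_lt.mp (hy2 z hz)⟩
  obtain ⟨l, sl, lmin⟩ := mini (fun x => ¬ s x) h.line
  obtain ⟨m0, ⟨sm0, ml0⟩, min0⟩ := mini (fun x => s x ∧ ¬ I x l)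
    (by obtain ⟨p, hp⟩ := h.off l l sl sl; exact ⟨p, hp.1, hp.2.1⟩)
  obtain ⟨m1, ⟨sm1, ml1, m01⟩, min1⟩ := mini (fun x => s x ∧ ¬ I x l ∧ x ≠ m0) (by
    obtain ⟨l', sl', hl'⟩ := h.thr m0 sm0
    obtain ⟨q, h1, h2, h3⟩ := h.off l l' sl sl'
    exact ⟨q, h1, h2, by rintro rfl; exact h3 hl'⟩)
  obtain ⟨l1, i0, i1⟩ := h.join m0 m1 m01.symm (by tauto)
  have sl1 : ¬ s l1 := by have := h.sort _ _ i0; tauto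
  obtain ⟨m2, ⟨sm2, ml2, m21⟩, min2⟩ := mini (fun x => s x ∧ ¬ I x l ∧ ¬ I x l1)
    (h.off l l1 sl sl1)
  have r02 : r m0 ≤ r m2 := min0 _ ⟨sm2, ml2⟩
  have r12 : r m1 ≤ r m2 := min1 _ ⟨sm2, ml2, by rintro rfl; exact m21 i0⟩
  set M := max (r m2) (r l) with hM
  have hM1 : r m2 ≤ M := le_max_left _ _
  have hM2 : r l ≤ M := le_max_right _ _
  let key : E → ℕ := fun z => if z = l then 0 else if z = m0 ∨ z = m1 ∨ z = m2 then 1 else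
    if r z < M then (if s z then (if I z l1 then 3 else 5) else
      (if z = l1 then 2 else if I m2 z then 4 else 6)) else r z + 7
  have hm2 : ∀ z, z = m0 ∨ z = m1 ∨ z = m2 → s z := by
    rintro z (rfl | rfl | rfl) <;> assumption
  have hml : ∀ z, z = m0 ∨ z = m1 ∨ z = m2 → ¬ I z l := by
    rintro z (rfl | rfl | rfl) <;> assumption
  have hmr : ∀ z, z = m0 ∨ z = m1 ∨ z = m2 → r z ≤ M := by
    rintro z (rfl | rfl | rfl) <;> omega
  have kl : key l = 0 := by simp [key]
  have km : ∀ z, z = m0 ∨ z = m1 ∨ z = m2 → key z = 1 := by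
    intro z hz
    have : z ≠ l := by rintro rfl; exact sl (hm2 _ hz)
    simp only [key, if_neg this, if_pos hz]
  let J : E → Prop := fun z => z = l ∨ (z = m0 ∨ z = m1 ∨ z = m2) ∨ r z < M
  have khigh : ∀ z, ¬ J z → key z = r z + 7 ∧ M ≤ r z := by
    intro z hz
    simp only [J, not_or, not_lt] at hz
    simp [key, hz]
  have lc : ∀ z, ¬ s z → J z → (z = l ∧ key z = 0) ∨ (z ≠ l ∧ z = l1 ∧ key z = 2) ∨
      (z ≠ l ∧ z ≠ l1 ∧ I m2 z ∧ key z = 4) ∨ (z ≠ l ∧ z ≠ l1 ∧ ¬ I m2 z ∧ key z = 6) := by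
    intro z hs hz
    by_cases h1 : z = l
    · left; exact ⟨h1, h1 ▸ kl⟩
    have h2 : ¬ (z = m0 ∨ z = m1 ∨ z = m2) := fun hh => hs (hm2 z hh)
    have h3 : r z < M := by simp only [J] at hz; tauto
    have h4 : key z = (if z = l1 then 2 else if I m2 z then 4 else 6) := by
      simp only [key, if_neg h1, if_neg h2, if_pos h3, if_neg hs]
    by_cases h5 : z = l1
    · rw [if_pos h5] at h4; tauto
    · by_cases h6 : I m2 z
      · rw [if_neg h5, if_pos h6] at h4; tauto
      · rw [if_neg h5, if_neg h6] at h4; tauto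
  have pc : ∀ z, s z → J z → ((z = m0 ∨ z = m1 ∨ z = m2) ∧ key z = 1) ∨
      (¬ (z = m0 ∨ z = m1 ∨ z = m2) ∧ I z l1 ∧ key z = 3) ∨
      (¬ (z = m0 ∨ z = m1 ∨ z = m2) ∧ ¬ I z l1 ∧ key z = 5) := by
    intro z hs hz
    by_cases h2 : (z = m0 ∨ z = m1 ∨ z = m2)
    · left; exact ⟨h2, km z h2⟩
    have h1 : z ≠ l := by rintro rfl; exact sl hs
    have h3 : r z < M := by simp only [J] at hz; tauto
    have h4 : key z = (if I z l1 then 3 else 5) := by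
      simp only [key, if_neg h1, if_neg h2, if_pos h3, if_pos hs]
    by_cases h5 : I z l1
    · rw [if_pos h5] at h4; tauto
    · rw [if_neg h5] at h4; tauto
  clear_value key
  have hcore : HF I key := by
    refine step_core (M := M) (J := J) h hr sl hm2 hml i0 i1 m21 ?_ ?_ khigh ?_ lc pc
    · intro z hz hzl hzJ
      have := lmin z hz
      have h2 : ¬ (z = m0 ∨ z = m1 ∨ z = m2) := fun hh => hz (hm2 z hh)
      have h3 : r z < M := by simp only [J] at hzJ; tauto
      omega
    · intro z hz hMm hzJ
      have h1 : z ≠ l := by rintro rfl; exact sl hz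
      by_cases h2 : (z = m0 ∨ z = m1 ∨ z = m2)
      · rcases h2 with rfl | rfl | rfl <;> tauto
      have h3 : r z < M := by simp only [J] at hzJ; tauto
      by_contra hh
      have := min2 z ⟨hz, by tauto, by tauto⟩
      omega
    · intro z hz
      refine ⟨?_, ?_⟩
      · by_cases hs : s z
        · have := pc z hs hz; omega
        · have := lc z hs hz; omega
      · rcases hz with rfl | hz | hz
        · exact hM2
        · exact hmr z hz
        · omega
  refine ⟨key, l, m0, m1, m2, l1, hcore, sl, sm0, sm1, sm2, ml0, ml1, ml2, m01.symm,
    i0, i1, m21, kl, km _ (by simp), km _ (by simp), km _ (by simp), ?_⟩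
  intro z hz
  by_cases hJ : J z
  · by_cases hs : s z
    · rcases pc z hs hJ with h1 | h1 | h1
      · exact .inr h1.1
      all_goals omega
    · rcases lc z hs hJ with h1 | h1 | h1 | h1
      · exact .inl h1.1
      all_goals omega
  · have := khigh z hJ; omega


theorem step_two (h : Pl I s) {r : E → ℕ} (hr : HF I r) :
    ∃ (r' : E → ℕ) (l m0 m1 m2 n0 n1 n2 : E),
      Frame I s l m0 m1 m2 n0 n1 n2 ∧ St I r' l m0 m1 m2 n0 n1 n2 := by
  classical
  obtain ⟨r, l, m0, m1, m2, n2, hr, sl, sm0, sm1, sm2, ml0, ml1, ml2, m01, i02, i12, j2,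
    rl, rm0, rm1, rm2, low⟩ := step_one h hr
  have m02 : m0 ≠ m2 := by rintro rfl; exact j2 i02
  have m12 : m1 ≠ m2 := by rintro rfl; exact j2 i12
  obtain ⟨n0, i10, i20⟩ := h.join m1 m2 m12 (by tauto)
  obtain ⟨n1, i01, i21⟩ := h.join m0 m2 m02 (by tauto)
  have sn0 : ¬ s n0 := by have := h.sort _ _ i10; tauto
  have sn1 : ¬ s n1 := by have := h.sort _ _ i01; tauto
  have sn2 : ¬ s n2 := by have := h.sort _ _ i02; tauto
  have j0 : ¬ I m0 n0 := by
    intro hh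
    rcases h.uniq m0 m1 n0 n2 hh i10 i02 i12 with h1 | h1
    · exact m01 h1
    · exact j2 (h1 ▸ i20)
  have j1 : ¬ I m1 n1 := by
    intro hh
    rcases h.uniq m0 m1 n1 n2 i01 hh i02 i12 with h1 | h1
    · exact m01 h1
    · exact j2 (h1 ▸ i21)
  have F : Frame I s l m0 m1 m2 n0 n1 n2 :=
    ⟨sl, sm0, sm1, sm2, sn0, sn1, sn2, ml0, ml1, ml2, i01, i02, i10, i12, i20, i21, j0, j1, j2⟩
  let r' : E → ℕ := fun z => if z = l then 0 else if z = m0 ∨ z = m1 ∨ z = m2 then 1 else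
    if z = n0 ∨ z = n1 ∨ z = n2 then 2 else r z + 3
  have sm : ∀ z, z = m0 ∨ z = m1 ∨ z = m2 → s z := by rintro z (rfl | rfl | rfl) <;> assumption
  have sn : ∀ z, z = n0 ∨ z = n1 ∨ z = n2 → ¬ s z := by rintro z (rfl | rfl | rfl) <;> assumption
  have nl : ∀ z, z = n0 ∨ z = n1 ∨ z = n2 → z ≠ l := by
    rintro z (rfl | rfl | rfl) rfl <;> tauto
  have cs : ∀ z, (z = l ∧ r' z = 0) ∨ ((z = m0 ∨ z = m1 ∨ z = m2) ∧ r' z = 1) ∨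
      ((z = n0 ∨ z = n1 ∨ z = n2) ∧ r' z = 2) ∨
      (z ≠ l ∧ ¬ (z = m0 ∨ z = m1 ∨ z = m2) ∧ ¬ (z = n0 ∨ z = n1 ∨ z = n2) ∧
        r' z = r z + 3 ∧ 2 ≤ r z) := by
    intro z
    by_cases h1 : z = l
    · left; simp [r', h1]
    by_cases h2 : z = m0 ∨ z = m1 ∨ z = m2
    · right; left; refine ⟨h2, ?_⟩; simp only [r', if_neg h1, if_pos h2]
    by_cases h3 : z = n0 ∨ z = n1 ∨ z = n2
    · right; right; left; refine ⟨h3, ?_⟩; simp only [r', if_neg h1, if_neg h2, if_pos h3]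
    · right; right; right; refine ⟨h1, h2, h3, ?_, ?_⟩
      · simp only [r', if_neg h1, if_neg h2, if_neg h3]
      · by_contra hh
        have := low z (by omega)
        tauto
  clear_value r'
  have hso := h.sort
  have side : ∀ z x, (z = n0 ∨ z = n1 ∨ z = n2) → I x z → ¬ (x = m0 ∨ x = m1 ∨ x = m2) →
      r z < r x := by
    intro z x hz hx hxm
    by_contra hh
    have hne := hr.ne _ _ hx
    have aux : ∀ m m' , r m = 1 → r m' = 1 → m ≠ m' → (m = m0 ∨ m = m1 ∨ m = m2) →
      (m' = m0 ∨ m' = m1 ∨ m' = m2) → I m z → I m' z → False := by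
      intro m m' h1 h2 h3 h4 h5 h6 h7
      have hz2 : 2 ≤ r z := by
        by_contra hlt
        rcases low z (by omega) with h8 | h8
        · exact nl z hz h8
        · exact sn z hz (sm z h8)
      rcases hr.two z m m' x ⟨h.symm _ _ h6, by omega⟩ ⟨h.symm _ _ h7, by omega⟩
        ⟨h.symm _ _ hx, by omega⟩ with h8 | h8 | h8
      · exact h3 h8
      · exact hxm (h8 ▸ h4)
      · exact hxm (h8 ▸ h5)
    rcases hz with rfl | rfl | rfl
    · exact aux m1 m2 rm1 rm2 m12 (by simp) (by simp) i10 i20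
    · exact aux m0 m2 rm0 rm2 m02 (by simp) (by simp) i01 i21
    · exact aux m0 m1 rm0 rm1 m01 (by simp) (by simp) i02 i12
  refine ⟨r', l, m0, m1, m2, n0, n1, n2, F, ⟨?_, ?_⟩, ?_, ?_, ?_, ?_, ?_, ?_, ?_, ?_⟩
  · intro x y hxy
    have h1 := hso _ _ hxy
    have h2 := hr.ne _ _ hxy
    rcases cs x with ⟨hx, kx⟩ | ⟨hx, kx⟩ | ⟨hx, kx⟩ | ⟨_, _, _, kx, _⟩ <;>
    rcases cs y with ⟨hy, ky⟩ | ⟨hy, ky⟩ | ⟨hy, ky⟩ | ⟨_, _, _, ky, _⟩ <;> try omega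
    · subst hx; subst hy; tauto
    · have := sm x hx; have := sm y hy; tauto
    · have := sn x hx; have := sn y hy; tauto
  · intro x a b c ha hb hc
    rcases cs x with ⟨hx, kx⟩ | ⟨hx, kx⟩ | ⟨hx, kx⟩ | ⟨x1, x2, x3, kx, x4⟩
    · have := ha.2; omega
    · exfalso
      have h1 := ha.2
      rcases cs a with ⟨hy, ky⟩ | ⟨hy, ky⟩ | ⟨hy, ky⟩ | ⟨_, _, _, ky, _⟩ <;> try omega
      subst hy
      have := ha.1
      rcases hx with rfl | rfl | rfl <;> tauto
    · have aux : ∀ y, O I r' x y → (y = m0 ∨ y = m1 ∨ y = m2) ∧ I y x := by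
        intro y hy
        refine ⟨?_, h.symm _ _ hy.1⟩
        have h1 := hy.2
        rcases cs y with ⟨hy', ky⟩ | ⟨hy', ky⟩ | ⟨hy', ky⟩ | ⟨_, _, _, ky, _⟩
        · have h2 := hso _ _ hy.1
          have := sn x hx
          subst hy'; tauto
        · exact hy'
        · omega
        · omega
      have h1 := aux a ha
      have h2 := aux b hb
      have h3 := aux c hc
      clear * - h1 h2 h3 hx j0 j1 j2
      grind
    · have aux : ∀ y, O I r' x y → O I r x y := by
        intro y hy
        refine ⟨hy.1, ?_⟩
        have h1 := hy.2
        rcases cs y with ⟨hy', ky⟩ | ⟨hy', ky⟩ | ⟨hy', ky⟩ | ⟨_, _, _, ky, _⟩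
        · rw [hy', rl]; omega
        · rcases hy' with rfl | rfl | rfl <;> omega
        · exact side y x hy' hy.1 x2
        · omega
      exact hr.two x a b c (aux a ha) (aux b hb) (aux c hc)
  all_goals clear * - cs sm sn sl low nl
  · rcases cs l with ⟨h1, k⟩ | ⟨h1, k⟩ | ⟨h1, k⟩ | ⟨h1, _⟩
    · exact k
    · exact absurd (sm l h1) sl
    · exact absurd rfl (nl l h1)
    · exact absurd rfl h1
  iterate 3
    · have vm : ∀ z, (z = m0 ∨ z = m1 ∨ z = m2) → r' z = 1 := by
        intro z hz
        rcases cs z with ⟨h1, k⟩ | ⟨h1, k⟩ | ⟨h1, k⟩ | ⟨_, h1, _⟩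
        · exact absurd (sm z hz) (h1 ▸ sl)
        · exact k
        · exact absurd (sm z hz) (sn z h1)
        · exact absurd hz h1
      exact vm _ (by simp)
  iterate 3
    · have vn : ∀ z, (z = n0 ∨ z = n1 ∨ z = n2) → r' z = 2 := by
        intro z hz
        rcases cs z with ⟨h1, k⟩ | ⟨h1, k⟩ | ⟨h1, k⟩ | ⟨_, _, h1, _⟩
        · exact absurd h1 (nl z hz)
        · exact absurd (sm z h1) (sn z hz)
        · exact k
        · exact absurd hz h1
      exact vn _ (by simp)
  · intro z hz
    rcases cs z with ⟨h1, k⟩ | ⟨h1, k⟩ | ⟨h1, k⟩ | ⟨_, _, h1, k, _⟩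
    · exact .inl h1
    · tauto
    · tauto
    · omega

/-- one round of simultaneous flips -/
theorem round (h : Pl I s) {r : E → ℕ} {l m0 m1 m2 n0 n1 n2 : E}
    (S : St I r l m0 m1 m2 n0 n1 n2) (G : E → Prop) (c : E → E)
    (hG : ∀ x, G x → 3 ≤ r x ∧ r (c x) < 3 ∧ (∀ a b, O I r x a → O I r x b → a = b) ∧
      ∃ y, I x y ∧ I (c x) y ∧ r x < r y) :
    ∃ r' : E → ℕ, St I r' l m0 m1 m2 n0 n1 n2 ∧
      ((∀ z, 3 ≤ r z → G z ∨ ∃ a, O I r z a) → (∀ z, 3 ≤ r' z → ∃ a, O I r' z a)) ∧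
      ((∀ z, 3 ≤ r z → ∃ a, O I r z a) → ∀ z a, 3 ≤ r' z → O I r' z a →
        (∀ b, O I r' z b → b = a) →
        (¬ G z ∧ 3 ≤ r z ∧ O I r z a ∧ ∀ b, O I r z b → b = a) ∨ ∃ x, G x ∧ a = c x) := by
  classical
  have hsy := h.symm
  have hne := S.hf.ne
  choose! g3 gc g1 y hy using hG
  have yout : ∀ x, G x → ∀ z, O I r (y x) z → z = x ∨ z = c x := by
    intro x hx z hz
    obtain ⟨h1, h2, h3⟩ := hy x hx
    have := g3 x hx
    have := gc x hx
    rcases S.hf.two (y x) x (c x) z ⟨hsy _ _ h1, h3⟩ ⟨hsy _ _ h2, by omega⟩ hz with h4 | h4 | h4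
    · rw [← h4] at this; omega
    · exact .inl h4.symm
    · exact .inr h4.symm
  have yinj : ∀ x x', G x → G x' → y x = y x' → x = x' := by
    intro x x' hx hx' he
    obtain ⟨h1, h2, h3⟩ := hy x hx
    rcases yout x' hx' x (he ▸ ⟨hsy _ _ h1, h3⟩) with h4 | h4
    · exact h4
    · have := gc x' hx'; have := g3 x hx; rw [← h4] at *; omega
  have yG : ∀ x x', G x → G x' → y x ≠ x' := by
    intro x x' hx hx' he
    obtain ⟨h1, h2, h3⟩ := hy x hx
    have h4 := gc x hx
    have h5 := g3 x hx
    have := g1 x' hx' x (c x) (he ▸ ⟨hsy _ _ h1, h3⟩) (he ▸ ⟨hsy _ _ h2, by omega⟩)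
    rw [← this] at h4; omega
  let r' : E → ℕ := fun z => if r z < 3 then r z else
    if hz : ∃ x, G x ∧ z = y x then 2 * r hz.choose else 2 * r z + 1
  have cB : ∀ z, r z < 3 → r' z = r z := by
    intro z hz; simp only [r', if_pos hz]
  have cY : ∀ x, G x → r' (y x) = 2 * r x := by
    intro x hx
    have h3 := g3 x hx
    have h4 := (hy x hx).2.2
    have hz : ∃ x', G x' ∧ y x = y x' := ⟨x, hx, rfl⟩
    have : ¬ r (y x) < 3 := by omega
    simp only [r', if_neg this, dif_pos hz]
    rw [← yinj x hz.choose hx hz.choose_spec.1 hz.choose_spec.2]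
  have cN : ∀ z, 3 ≤ r z → (¬ ∃ x, G x ∧ z = y x) → r' z = 2 * r z + 1 := by
    intro z hz hn
    have : ¬ r z < 3 := by omega
    simp only [r', if_neg this, dif_neg hn]
  clear_value r'
  have cs : ∀ z, (r z < 3 ∧ r' z = r z) ∨ (∃ x, G x ∧ z = y x ∧ 3 ≤ r z ∧ r' z = 2 * r x) ∨
      (3 ≤ r z ∧ (¬ ∃ x, G x ∧ z = y x) ∧ r' z = 2 * r z + 1) := by
    intro z
    by_cases h1 : r z < 3
    · exact .inl ⟨h1, cB z h1⟩
    · by_cases h2 : ∃ x, G x ∧ z = y x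
      · obtain ⟨x, hx, rfl⟩ := h2
        exact .inr (.inl ⟨x, hx, rfl, by omega, cY x hx⟩)
      · exact .inr (.inr ⟨by omega, h2, cN z (by omega) h2⟩)
  have le3 : ∀ z, 3 ≤ r' z → 3 ≤ r z := by
    intro z hz
    rcases cs z with h1 | ⟨x, h1, h2, h3, h4⟩ | h1 <;> omega
  have le3' : ∀ z, 3 ≤ r z → 6 ≤ r' z := by
    intro z hz
    rcases cs z with h1 | ⟨x, h1, h2, h3, h4⟩ | h1
    · omega
    · have := g3 x h1; omega
    · omega
  have fwd : ∀ z w, I z w → r w < r z → (∃ x, G x ∧ z = y x ∧ w = x) ∨ r' w < r' z := by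
    intro z w hzw hlt
    rcases cs z with ⟨h1, h2⟩ | ⟨x, hx, rfl, h1, h2⟩ | ⟨h1, hn, h2⟩
    · have := cB w (by omega); right; omega
    · rcases yout x hx w ⟨hzw, hlt⟩ with h3 | h3
      · exact .inl ⟨x, hx, rfl, h3⟩
      · right
        have h5 := gc x hx
        have := g3 x hx
        have := cB (c x) h5
        rw [h3]; omega
    · right
      rcases cs w with ⟨h3, h4⟩ | ⟨x', hx', rfl, h3, h4⟩ | ⟨h3, h5, h4⟩
      · omega
      · have := (hy x' hx').2.2; omega
      · omega
  have flip : ∀ x, G x → r' (y x) < r' x := by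
    intro x hx
    have := cY x hx
    have := cN x (g3 x hx) (by rintro ⟨x', h1, h2⟩; exact yG x' x h1 hx h2.symm)
    omega
  have new : ∀ z w, O I r' z w → (O I r z w ∧ ¬ ∃ x, G x ∧ z = y x ∧ w = x) ∨ (G z ∧ w = y z) := by
    intro z w ⟨h1, h2⟩
    rcases lt_or_gt_of_ne (hne z w h1) with h3 | h3
    · rcases fwd w z (hsy _ _ h1) h3 with ⟨x, hx, h4, h5⟩ | h4
      · right; rw [h5]; exact ⟨hx, h4⟩
      · omega
    · left
      refine ⟨⟨h1, h3⟩, ?_⟩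
      rintro ⟨x, hx, rfl, rfl⟩
      have := flip w hx
      omega
  have old : ∀ z w, O I r z w → (¬ ∃ x, G x ∧ z = y x ∧ w = x) → O I r' z w := by
    intro z w h1 h2
    refine ⟨h1.1, ?_⟩
    rcases fwd z w h1.1 h1.2 with h3 | h3
    · exact absurd h3 h2
    · exact h3
  have newy : ∀ x, G x → O I r' x (y x) := fun x hx => ⟨(hy x hx).1, flip x hx⟩
  have newc : ∀ x, G x → O I r' (y x) (c x) := by
    intro x hx
    refine ⟨hsy _ _ (hy x hx).2.1, ?_⟩
    have := gc x hx
    have := cB _ this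
    have := cY x hx
    have := g3 x hx
    omega
  refine ⟨r', ⟨⟨?_, ?_⟩, ?_, ?_, ?_, ?_, ?_, ?_, ?_, ?_⟩, ?_, ?_⟩
  · intro z w hzw
    rcases lt_or_gt_of_ne (hne z w hzw) with h3 | h3
    · rcases fwd w z (hsy _ _ hzw) h3 with ⟨x, hx, h4, h5⟩ | h4
      · have := flip x hx; rw [h4, h5]; omega
      · omega
    · rcases fwd z w hzw h3 with ⟨x, hx, h4, h5⟩ | h4
      · have := flip x hx; rw [h4, h5]; omega
      · omega
  · intro z a b d ha hb hd
    have ha' := new z a ha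
    have hb' := new z b hb
    have hd' := new z d hd
    have h2 := S.hf.two z a b d
    have h1 := g1 z
    clear * - ha' hb' hd' h1 h2
    grind
  · rw [cB _ (by rw [S.rl]; omega), S.rl]
  · rw [cB _ (by rw [S.rm0]; omega), S.rm0]
  · rw [cB _ (by rw [S.rm1]; omega), S.rm1]
  · rw [cB _ (by rw [S.rm2]; omega), S.rm2]
  · rw [cB _ (by rw [S.rn0]; omega), S.rn0]
  · rw [cB _ (by rw [S.rn1]; omega), S.rn1]
  · rw [cB _ (by rw [S.rn2]; omega), S.rn2]
  · intro z hz
    apply S.low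
    by_contra hh
    have := le3' z (by omega)
    omega
  · intro hyp z hz
    by_cases h1 : ∃ x, G x ∧ z = y x
    · obtain ⟨x, hx, rfl⟩ := h1
      exact ⟨_, newc x hx⟩
    · rcases hyp z (le3 z hz) with h2 | ⟨a, ha⟩
      · exact ⟨_, newy z h2⟩
      · exact ⟨a, old z a ha (by rintro ⟨x, h3, h4, -⟩; exact h1 ⟨x, h3, h4⟩)⟩
  · intro hyp z a hz ha huniq
    by_cases h1 : ∃ x, G x ∧ z = y x
    · obtain ⟨x, hx, rfl⟩ := h1
      exact .inr ⟨x, hx, (huniq _ (newc x hx)).symm⟩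
    · have hold : ∀ b, O I r z b → b = a := by
        intro b hb
        exact huniq b (old z b hb (by rintro ⟨x, h3, h4, -⟩; exact h1 ⟨x, h3, h4⟩))
      left
      have hGz : ¬ G z := by
        intro hGz
        have h4 := huniq _ (newy z hGz)
        obtain ⟨b, hb⟩ := hyp z (le3 z hz)
        have h5 := hold b hb
        rw [h5, ← h4] at hb
        have := hb.2
        have := (hy z hGz).2.2
        omega
      refine ⟨hGz, le3 z hz, ?_, hold⟩
      rcases new z a ha with h2 | h2
      · exact h2.1
      · exact absurd h2.1 hGz

theorem step_three (h : Pl I s) {r : E → ℕ} (hr : HF I r) :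
    ∃ (r' : E → ℕ) (l m0 m1 m2 n0 n1 n2 : E),
      Frame I s l m0 m1 m2 n0 n1 n2 ∧ St I r' l m0 m1 m2 n0 n1 n2 ∧
      ∀ z, 3 ≤ r' z → (∃ a b, a ≠ b ∧ O I r' z a ∧ O I r' z b) ∨
        (∀ b, O I r' z b ↔ b = l) := by
  classical
  obtain ⟨r, l, m0, m1, m2, n0, n1, n2, F, S⟩ := step_two h hr
  have hso := h.sort
  have hsy := h.symm
  have mk : ∀ r : E → ℕ, St I r l m0 m1 m2 n0 n1 n2 → ∀ x d, 3 ≤ r x → r d < 3 → (s x ↔ s d) →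
      (∀ b, O I r x b → ¬ I b d) → ∃ y, I x y ∧ I d y ∧ r x < r y := by
    intro r S x d hx hd hs hb
    obtain ⟨y, h1, h2⟩ := h.join x d (by rintro rfl; omega) hs
    refine ⟨y, h1, h2, ?_⟩
    by_contra hh
    have := S.hf.ne _ _ h1
    exact hb y ⟨h1, by omega⟩ (hsy _ _ h2)
  obtain ⟨rA, SA, neA, -⟩ := round h S (fun x => 3 ≤ r x ∧ ∀ b, ¬ O I r x b)
    (fun x => if s x then m0 else l) (by
      rintro x ⟨hx, hb⟩
      refine ⟨hx, ?_, fun a b ha => absurd ha (hb a), ?_⟩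
      · split_ifs
        · rw [S.rm0]; omega
        · rw [S.rl]; omega
      · refine mk r S x _ hx ?_ ?_ (fun b h => absurd h (hb b))
        · split_ifs
          · rw [S.rm0]; omega
          · rw [S.rl]; omega
        · split_ifs with h1
          · exact iff_of_true h1 F.sm0
          · exact iff_of_false h1 F.sl)
  replace neA := neA (by
    intro z hz
    by_cases hh : ∃ a, O I r z a
    · exact .inr hh
    · push Not at hh; exact .inl ⟨hz, hh⟩)
  have hexB : ∀ q, I q l → ∃ n, rA n < 3 ∧ ¬ s n ∧ ¬ I q n := by
    intro q hq
    have h1 : rA n0 < 3 := by rw [SA.rn0]; omega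
    have h2 : rA n1 < 3 := by rw [SA.rn1]; omega
    by_cases hq0 : I q n0
    · by_cases hq1 : I q n1
      · exfalso
        rcases h.uniq q m2 n0 n1 hq0 F.i20 hq1 F.i21 with h3 | h3
        · exact F.ml2 (h3 ▸ hq)
        · exact F.j0 (h3 ▸ F.i01)
      · exact ⟨n1, h2, F.sn1, hq1⟩
    · exact ⟨n0, h1, F.sn0, hq0⟩
  choose! nB nB1 nB2 nB3 using hexB
  have hcB : ∀ x, ∃ d, ∀ a, (¬ s x ∧ I a l ∧ O I rA x a ∧ ∀ b, O I rA x b → b = a) → d = nB a := by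
    intro x
    by_cases hh : ∃ a, O I rA x a ∧ ∀ b, O I rA x b → b = a
    · obtain ⟨a, ha, ha'⟩ := hh
      refine ⟨nB a, ?_⟩
      rintro a' ⟨-, -, h3, h4⟩
      rw [ha' a' h3]
    · exact ⟨x, fun a ⟨_, _, h3, h4⟩ => absurd ⟨a, h3, h4⟩ hh⟩
  choose cB hcB using hcB
  obtain ⟨rB, SB, neB, tB⟩ := round h SA
    (fun x => 3 ≤ rA x ∧ ∃ a, (¬ s x ∧ I a l ∧ O I rA x a ∧ ∀ b, O I rA x b → b = a)) cB (by
      rintro x ⟨hx, a, hxa⟩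
      have hc := hcB x a hxa
      obtain ⟨hs, hal, ha, hu⟩ := hxa
      have h1 := nB1 a hal
      rw [hc]
      refine ⟨hx, h1, fun b d hb hd => by rw [hu b hb, hu d hd], ?_⟩
      refine mk rA SA x _ hx h1 (iff_of_false hs (nB2 a hal)) ?_
      intro b hb
      rw [hu b hb]
      exact nB3 a hal)
  replace neB := neB (fun z hz => .inr (neA z hz))
  replace tB : ∀ z a, 3 ≤ rB z → O I rB z a → (∀ b, O I rB z b → b = a) → ¬ s z → ¬ I a l := by
    intro z a hz ha hu hs hal
    rcases tB neA z a hz ha hu with ⟨h1, h2, h3, h4⟩ | ⟨x, ⟨hx, a', hxa⟩, h2⟩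
    · exact h1 ⟨h2, a, hs, hal, h3, h4⟩
    · rw [hcB x a' hxa] at h2
      have h3 := nB2 a' hxa.2.1
      have h4 := hso _ _ ha.1
      rw [h2] at h4
      tauto
  have hexC : ∀ k, ∃ m, rB m < 3 ∧ s m ∧ ¬ I k m ∧ ¬ I m l := by
    intro k
    have h0 : rB m0 < 3 := by rw [SB.rm0]; omega
    have h1 : rB m1 < 3 := by rw [SB.rm1]; omega
    have h2 : rB m2 < 3 := by rw [SB.rm2]; omega
    by_cases hk0 : I k m0
    · by_cases hk1 : I k m1
      · refine ⟨m2, h2, F.sm2, ?_, F.ml2⟩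
        intro hk2
        rcases h.uniq m0 m1 k n2 (hsy _ _ hk0) (hsy _ _ hk1) F.i02 F.i12 with h3 | h3
        · exact F.j0 (h3 ▸ F.i10)
        · exact F.j2 (h3 ▸ (hsy _ _ hk2))
      · exact ⟨m1, h1, F.sm1, hk1, F.ml1⟩
    · exact ⟨m0, h0, F.sm0, hk0, F.ml0⟩
  choose mC mC1 mC2 mC3 mC4 using hexC
  have hcC : ∀ x, ∃ d, ∀ a, (s x ∧ a ≠ l ∧ O I rB x a ∧ ∀ b, O I rB x b → b = a) → d = mC a := by
    intro x
    by_cases hh : ∃ a, O I rB x a ∧ ∀ b, O I rB x b → b = a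
    · obtain ⟨a, ha, ha'⟩ := hh
      refine ⟨mC a, ?_⟩
      rintro a' ⟨-, -, h3, h4⟩
      rw [ha' a' h3]
    · exact ⟨x, fun a ⟨_, _, h3, h4⟩ => absurd ⟨a, h3, h4⟩ hh⟩
  choose cC hcC using hcC
  obtain ⟨rC, SC, neC, tC⟩ := round h SB
    (fun x => 3 ≤ rB x ∧ ∃ a, (s x ∧ a ≠ l ∧ O I rB x a ∧ ∀ b, O I rB x b → b = a)) cC (by
      rintro x ⟨hx, a, hxa⟩
      have hc := hcC x a hxa
      obtain ⟨hs, hal, ha, hu⟩ := hxa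
      rw [hc]
      refine ⟨hx, mC1 a, fun b d hb hd => by rw [hu b hb, hu d hd], ?_⟩
      refine mk rB SB x _ hx (mC1 a) (iff_of_true hs (mC2 a)) ?_
      intro b hb
      rw [hu b hb]
      exact mC3 a)
  replace neC := neC (fun z hz => .inr (neB z hz))
  replace tC : ∀ z a, 3 ≤ rC z → O I rC z a → (∀ b, O I rC z b → b = a) →
      (s z → a = l) ∧ (¬ s z → ¬ I a l) := by
    intro z a hz ha hu
    rcases tC neB z a hz ha hu with ⟨h1, h2, h3, h4⟩ | ⟨x, ⟨hx, a', hxa⟩, h2⟩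
    · refine ⟨fun hs => ?_, fun hs => tB z a h2 h3 h4 hs⟩
      by_contra hal
      exact h1 ⟨h2, a, hs, hal, h3, h4⟩
    · rw [hcC x a' hxa] at h2
      have h4 := hso _ _ ha.1
      rw [h2] at h4 ⊢
      have := mC2 a'
      exact ⟨fun hs => by tauto, fun _ => mC4 a'⟩
  obtain ⟨rD, SD, neD, tD⟩ := round h SC
    (fun x => 3 ≤ rC x ∧ ∃ a, (¬ s x ∧ O I rC x a ∧ ∀ b, O I rC x b → b = a)) (fun _ => l) (by
      rintro x ⟨hx, a, hs, ha, hu⟩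
      have hl : rC l < 3 := by rw [SC.rl]; omega
      refine ⟨hx, hl, fun b d hb hd => by rw [hu b hb, hu d hd], ?_⟩
      refine mk rC SC x _ hx hl (iff_of_false hs F.sl) ?_
      intro b hb
      rw [hu b hb]
      exact (tC x a hx ha hu).2 hs)
  replace neD := neD (fun z hz => .inr (neC z hz))
  refine ⟨rD, l, m0, m1, m2, n0, n1, n2, F, SD, ?_⟩
  intro z hz
  obtain ⟨a, ha⟩ := neD z hz
  by_cases hu : ∀ b, O I rD z b → b = a
  · right
    have hal : a = l := by
      rcases tD neC z a hz ha hu with ⟨h1, h2, h3, h4⟩ | ⟨x, -, h2⟩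
      · have hs : s z := by
          by_contra hs
          exact h1 ⟨h2, a, hs, h3, h4⟩
        exact (tC z a h2 h3 h4).1 hs
      · exact h2
    intro b
    rw [← hal]
    exact ⟨hu b, fun hb => hb ▸ ha⟩
  · left
    push Not at hu
    obtain ⟨b, hb, hba⟩ := hu
    exact ⟨b, a, hba, hb, ha⟩


/-- partial isomorphisms with down-closed domain and range -/
structure PI {E E' : Type u} (I : E → E → Prop) (s : E → Prop) (r : E → ℕ)
    (I' : E' → E' → Prop) (s' : E' → Prop) (r' : E' → ℕ) (R : Set (E × E')) : Prop where
  inj : ∀ x y c d, (x, c) ∈ R → (y, d) ∈ R → (x = y ↔ c = d)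
  inc : ∀ x y c d, (x, c) ∈ R → (y, d) ∈ R → (I x y ↔ I' c d)
  srt : ∀ x c, (x, c) ∈ R → (s x ↔ s' c)
  d1 : ∀ x c, (x, c) ∈ R → ∀ y, O I r x y → ∃ d, (y, d) ∈ R
  d2 : ∀ x c, (x, c) ∈ R → ∀ d, O I' r' c d → ∃ y, (y, d) ∈ R

variable {E' : Type u} {I' : E' → E' → Prop} {s' : E' → Prop}

theorem PI.swap {r : E → ℕ} {r' : E' → ℕ} {R : Set (E × E')} (h : PI I s r I' s' r' R) :
    PI I' s' r' I s r (Prod.swap ⁻¹' R) :=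
  ⟨fun x y c d hx hy => (h.inj c d x y hx hy).symm, fun x y c d hx hy => (h.inc c d x y hx hy).symm,
    fun x c hx => (h.srt c x hx).symm, fun x c hx y hy => h.d2 c x hx y hy,
    fun x c hx y hy => h.d1 c x hx y hy⟩

theorem PI.ext (p : Pl I s) (p' : Pl I' s') {r : E → ℕ} {r' : E' → ℕ} (hr : HF I r)
    (hr' : HF I' r') {R : Set (E × E')} (h : PI I s r I' s' r' R) {x a b : E}
    (hx : ∀ c, (x, c) ∉ R) (hd : ∀ y, O I r x y → ∃ d, (y, d) ∈ R) (hab : a ≠ b)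
    (ha : O I r x a) (hb : O I r x b) : ∃ c, PI I s r I' s' r' (insert (x, c) R) := by
  obtain ⟨a', haR⟩ := hd a ha
  obtain ⟨b', hbR⟩ := hd b hb
  have hab' : a' ≠ b' := fun e => hab ((h.inj _ _ _ _ haR hbR).2 e)
  have sa := h.srt _ _ haR
  have sb := h.srt _ _ hbR
  have s1 := p.sort _ _ ha.1
  have s2 := p.sort _ _ hb.1
  obtain ⟨c, hac, hbc⟩ := p'.join a' b' hab' (by tauto)
  have hc : ∀ y, (y, c) ∉ R := by
    intro y hy
    have h1 := (h.inc _ _ _ _ haR hy).2 hac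
    have h2 := (h.inc _ _ _ _ hbR hy).2 hbc
    rcases p.uniq a b y x h1 h2 (p.symm _ _ ha.1) (p.symm _ _ hb.1) with h3 | h3
    · exact hab h3
    · exact hx c (h3 ▸ hy)
  have scc := p'.sort _ _ hac
  have lowx : ∀ y d, (y, d) ∈ R → I x y → O I r x y := by
    intro y d hy hxy
    refine ⟨hxy, ?_⟩
    by_contra hh
    have := hr.ne _ _ hxy
    obtain ⟨e, he⟩ := h.d1 y d hy x ⟨p.symm _ _ hxy, by omega⟩
    exact hx e he
  have lowc : ∀ y d, (y, d) ∈ R → I' c d → O I' r' c d := by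
    intro y d hy hxy
    refine ⟨hxy, ?_⟩
    by_contra hh
    have := hr'.ne _ _ hxy
    obtain ⟨e, he⟩ := h.d2 y d hy c ⟨p'.symm _ _ hxy, by omega⟩
    exact hc e he
  have ha' : O I' r' c a' := lowc a a' haR (p'.symm _ _ hac)
  have hb' : O I' r' c b' := lowc b b' hbR (p'.symm _ _ hbc)
  have outx : ∀ y, O I r x y → y = a ∨ y = b := by
    intro y hy
    rcases hr.two x a b y ha hb hy with h1 | h1 | h1
    · exact absurd h1 hab
    · exact .inl h1.symm
    · exact .inr h1.symm
  have outc : ∀ y, O I' r' c y → y = a' ∨ y = b' := by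
    intro y hy
    rcases hr'.two c a' b' y ha' hb' hy with h1 | h1 | h1
    · exact absurd h1 hab'
    · exact .inl h1.symm
    · exact .inr h1.symm
  have key : ∀ y d, (y, d) ∈ R → (I x y ↔ I' c d) := by
    intro y d hy
    constructor
    · intro h1
      rcases outx y (lowx y d hy h1) with rfl | rfl
      · rw [← (h.inj _ _ _ _ haR hy).1 rfl]; exact ha'.1
      · rw [← (h.inj _ _ _ _ hbR hy).1 rfl]; exact hb'.1
    · intro h1
      rcases outc d (lowc y d hy h1) with rfl | rfl
      · rw [← (h.inj _ _ _ _ haR hy).2 rfl]; exact ha.1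
      · rw [← (h.inj _ _ _ _ hbR hy).2 rfl]; exact hb.1
  have irx : ¬ I x x := fun hh => hr.ne _ _ hh rfl
  have irc : ¬ I' c c := fun hh => hr'.ne _ _ hh rfl
  refine ⟨c, ⟨?_, ?_, ?_, ?_, ?_⟩⟩
  · rintro y z d e (hy | hy) (hz | hz)
    · cases hy; cases hz; simp
    · cases hy
      exact iff_of_false (fun e1 => hx e (e1 ▸ hz)) (fun e1 => hc z (e1 ▸ hz))
    · cases hz
      exact iff_of_false (fun e1 => hx d (e1 ▸ hy)) (fun e1 => hc y (e1 ▸ hy))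
    · exact h.inj _ _ _ _ hy hz
  · rintro y z d e (hy | hy) (hz | hz)
    · cases hy; cases hz; exact iff_of_false irx irc
    · cases hy
      exact key z e hz
    · cases hz
      have := key y d hy
      exact ⟨fun h1 => p'.symm _ _ (this.1 (p.symm _ _ h1)),
        fun h1 => p.symm _ _ (this.2 (p'.symm _ _ h1))⟩
    · exact h.inc _ _ _ _ hy hz
  · rintro y d (hy | hy)
    · cases hy; tauto
    · exact h.srt _ _ hy
  · rintro y d (hy | hy) z hz
    · cases hy
      obtain ⟨e, he⟩ := hd z hz
      exact ⟨e, .inr he⟩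
    · obtain ⟨e, he⟩ := h.d1 y d hy z hz
      exact ⟨e, .inr he⟩
  · rintro y d (hy | hy) z hz
    · cases hy
      rcases outc z hz with rfl | rfl
      · exact ⟨a, .inr haR⟩
      · exact ⟨b, .inr hbR⟩
    · obtain ⟨e, he⟩ := h.d2 y d hy z hz
      exact ⟨e, .inr he⟩

theorem PI.total (p : Pl I s) (p' : Pl I' s') {r : E → ℕ} {r' : E' → ℕ} (hr : HF I r)
    (hr' : HF I' r') {R : Set (E × E')} (h : PI I s r I' s' r' R)
    (hmax : ∀ R', PI I s r I' s' r' R' → R ⊆ R' → R' ⊆ R)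
    (hout : ∀ x, (∃ c, (x, c) ∈ R) ∨ ∃ a b, a ≠ b ∧ O I r x a ∧ O I r x b) :
    ∀ x, ∃ c, (x, c) ∈ R := by
  by_contra hh
  push Not at hh
  obtain ⟨x, hx, hmin⟩ := (measure r).wf.has_min {x | ∀ c, (x, c) ∉ R} hh
  have hd : ∀ y, O I r x y → ∃ d, (y, d) ∈ R := by
    intro y hy
    by_contra hn
    push Not at hn
    exact hmin y hn hy.2
  rcases hout x with ⟨c, hc⟩ | ⟨a, b, hab, ha, hb⟩
  · exact hx c hc
  · obtain ⟨c, hc⟩ := h.ext p p' hr hr' hx hd hab ha hb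
    exact hx c (hmax _ hc (Set.subset_insert _ _) (Set.mem_insert _ _))

theorem PI.iso (p : Pl I s) (p' : Pl I' s') {r : E → ℕ} {r' : E' → ℕ} (hr : HF I r)
    (hr' : HF I' r') {R₀ : Set (E × E')} (h₀ : PI I s r I' s' r' R₀)
    (hout : ∀ x, (∃ c, (x, c) ∈ R₀) ∨ ∃ a b, a ≠ b ∧ O I r x a ∧ O I r x b)
    (hout' : ∀ c, (∃ x, (x, c) ∈ R₀) ∨ ∃ a b, a ≠ b ∧ O I' r' c a ∧ O I' r' c b) :
    ∃ f : E ≃ E', (∀ x, s x ↔ s' (f x)) ∧ ∀ x y, I x y ↔ I' (f x) (f y) := by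
  obtain ⟨R, hR0, hR⟩ := zorn_subset_nonempty {R | PI I s r I' s' r' R} (by
    intro C hC hchain hne
    refine ⟨⋃₀ C, ?_, fun t ht => Set.subset_sUnion_of_mem ht⟩
    have two : ∀ u v, u ∈ ⋃₀ C → v ∈ ⋃₀ C → ∃ T ∈ C, u ∈ T ∧ v ∈ T := by
      rintro u v ⟨T, hT, hu⟩ ⟨T', hT', hv⟩
      rcases hchain.total hT hT' with h1 | h1
      · exact ⟨T', hT', h1 hu, hv⟩
      · exact ⟨T, hT, hu, h1 hv⟩
    refine ⟨?_, ?_, ?_, ?_, ?_⟩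
    · intro x y c d hx hy
      obtain ⟨T, hT, h1, h2⟩ := two _ _ hx hy
      exact (hC hT).inj _ _ _ _ h1 h2
    · intro x y c d hx hy
      obtain ⟨T, hT, h1, h2⟩ := two _ _ hx hy
      exact (hC hT).inc _ _ _ _ h1 h2
    · rintro x c ⟨T, hT, h1⟩
      exact (hC hT).srt _ _ h1
    · rintro x c ⟨T, hT, h1⟩ y hy
      obtain ⟨d, hd⟩ := (hC hT).d1 _ _ h1 y hy
      exact ⟨d, T, hT, hd⟩
    · rintro x c ⟨T, hT, h1⟩ y hy
      obtain ⟨d, hd⟩ := (hC hT).d2 _ _ h1 y hy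
      exact ⟨d, T, hT, hd⟩) R₀ h₀
  have hP : PI I s r I' s' r' R := hR.1
  have hmax : ∀ R', PI I s r I' s' r' R' → R ⊆ R' → R' ⊆ R := fun R' h1 h2 => hR.2 h1 h2
  have t1 := hP.total p p' hr hr' hmax (fun x => (hout x).imp_left
    fun ⟨c, hc⟩ => ⟨c, hR0 hc⟩)
  have t2 := hP.swap.total p' p hr' hr (fun R' h1 h2 => by
    rintro ⟨c, x⟩ hu
    exact hmax _ h1.swap (fun u hu => h2 (by simpa using hu)) (show (x, c) ∈ _ from hu))
    (fun x => (hout' x).imp_left fun ⟨c, hc⟩ => ⟨c, hR0 hc⟩)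
  choose f hf using t1
  choose g hg using t2
  refine ⟨⟨f, g, fun x => ?_, fun c => ?_⟩, fun x => hP.srt _ _ (hf x),
    fun x y => hP.inc _ _ _ _ (hf x) (hf y)⟩
  · exact (hP.inj _ _ _ _ (hg (f x)) (hf x)).2 rfl
  · exact (hP.inj _ _ _ _ (hf (g c)) (hg c)).1 rfl

theorem card_le (p : Pl I s) {r : E → ℕ} {X : Set E}
    (hout : ∀ z, z ∉ X → ∃ a b, a ≠ b ∧ O I r z a ∧ O I r z b) : #E ≤ max #X ℵ₀ := by
  have key : ∀ n : ℕ, #{z | r z < n} ≤ max #X ℵ₀ := by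
    intro n
    induction n with
    | zero => simp
    | succ n ih =>
      have hsub : {z | r z < n + 1} ⊆ X ∪ {z | r z < n + 1 ∧ z ∉ X} := by
        intro z hz
        by_cases h1 : z ∈ X
        · exact .inl h1
        · exact .inr ⟨hz, h1⟩
      have hw : ∀ z : {z | r z < n + 1 ∧ z ∉ X}, ∃ ab : {z | r z < n} × {z | r z < n},
          ab.1.1 ≠ ab.2.1 ∧ I z.1 ab.1.1 ∧ I z.1 ab.2.1 := by
        rintro ⟨z, hz, hzX⟩
        obtain ⟨a, b, hab, ha, hb⟩ := hout z hzX
        have h1 := ha.2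
        have h2 := hb.2
        exact ⟨⟨⟨a, show r a < n by omega⟩, ⟨b, show r b < n by omega⟩⟩, hab, ha.1, hb.1⟩
      choose w hw using hw
      have winj : Function.Injective w := by
        intro z z' hzz
        obtain ⟨h1, h2, h3⟩ := hw z
        obtain ⟨-, h5, h6⟩ := hw z'
        rw [← hzz] at h5 h6
        rcases p.uniq z.1 z'.1 _ _ h2 h5 h3 h6 with h7 | h7
        · exact Subtype.ext h7
        · exact absurd h7 h1
      have h1 : #{z | r z < n + 1 ∧ z ∉ X} ≤ max #X ℵ₀ := by
        refine (Cardinal.mk_le_of_injective winj).trans ?_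
        rw [Cardinal.mk_prod, Cardinal.lift_id]
        exact Cardinal.mul_le_of_le (le_max_right _ _) ih ih
      refine (Cardinal.mk_le_mk_of_subset hsub).trans ((Cardinal.mk_union_le _ _).trans ?_)
      exact Cardinal.add_le_of_le (le_max_right _ _) (le_max_left _ _) h1
  have hU : (⋃ n : ULift.{u} ℕ, {z | r z < n.down}) = Set.univ := by
    ext z
    simp only [Set.mem_iUnion, Set.mem_univ, iff_true]
    exact ⟨⟨r z + 1⟩, Nat.lt_succ_self _⟩
  rw [← Cardinal.mk_univ, ← hU]
  refine (Cardinal.mk_iUnion_le _).trans ?_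
  refine Cardinal.mul_le_of_le (le_max_right _ _) ?_ (ciSup_le' fun n => key n.down)
  simp

structure Base (I : E → E → Prop) (s : E → Prop) (r : E → ℕ) (l : E) (m : Fin 3 → E)
    (T : Set E) : Prop where
  sl : ¬ s l
  sm : ∀ i, s (m i)
  st : ∀ t ∈ T, s t
  ml : ∀ i, ¬ I (m i) l
  tl : ∀ t ∈ T, I t l
  mi : ∀ i j, m i = m j → i = j
  mt : ∀ i, m i ∉ T
  ol : ∀ b, ¬ O I r l b
  om : ∀ i b, ¬ O I r (m i) b
  ot : ∀ t ∈ T, ∀ b, O I r t b → b = l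
  out : ∀ z, z = l ∨ (∃ i, z = m i) ∨ z ∈ T ∨ ∃ a b, a ≠ b ∧ O I r z a ∧ O I r z b

theorem exists_base (h : Pl I s) {r : E → ℕ} (hr : HF I r) :
    ∃ r' l m T, HF I r' ∧ Base I s r' l m T := by
  obtain ⟨r, l, m0, m1, m2, n0, n1, n2, F, S, N⟩ := step_three h hr
  have hsy := h.symm
  have hso := h.sort
  have low0 : ∀ z, r z < 1 → z = l := by
    intro z hz
    have h1 := S.rm0
    have h2 := S.rm1
    have h3 := S.rm2
    have h4 := S.rn0
    have h5 := S.rn1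
    have h6 := S.rn2
    rcases S.low z (by omega) with rfl | rfl | rfl | rfl | rfl | rfl | rfl
    · rfl
    all_goals omega
  have rm : ∀ i, r ((![m0, m1, m2] : Fin 3 → E) i) = 1 := by
    intro i
    fin_cases i
    · exact S.rm0
    · exact S.rm1
    · exact S.rm2
  have ml : ∀ i, ¬ I ((![m0, m1, m2] : Fin 3 → E) i) l := by
    intro i
    fin_cases i
    · exact F.ml0
    · exact F.ml1
    · exact F.ml2
  have m01 : m0 ≠ m1 := by rintro rfl; exact F.j0 F.i10
  have m02 : m0 ≠ m2 := by rintro rfl; exact F.j0 F.i20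
  have m12 : m1 ≠ m2 := by rintro rfl; exact F.j1 F.i21
  have tl : ∀ t, t ∈ {z | 3 ≤ r z ∧ ∀ b, O I r z b ↔ b = l} → I t l := by
    intro t ht
    exact ((ht.2 l).2 rfl).1
  refine ⟨r, l, ![m0, m1, m2], {z | 3 ≤ r z ∧ ∀ b, O I r z b ↔ b = l}, S.hf,
    F.sl, ?_, ?_, ml, tl, ?_, ?_, ?_, ?_, ?_, ?_⟩
  · intro i
    fin_cases i
    · exact F.sm0
    · exact F.sm1
    · exact F.sm2
  · intro t ht
    have h1 := hso _ _ (tl t ht)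
    have := F.sl
    tauto
  · intro i j
    fin_cases i <;> fin_cases j <;> simp [m01, m02, m12, m01.symm, m02.symm, m12.symm]
  · intro i hi
    have h1 := hi.1
    rw [rm i] at h1
    omega
  · intro b hb
    have h1 := hb.2
    rw [S.rl] at h1
    omega
  · intro i b hb
    have h1 := hb.2
    rw [rm i] at h1
    have := low0 b h1
    exact ml i (this ▸ hb.1)
  · intro t ht b hb
    exact (ht.2 b).1 hb
  · intro z
    by_cases hz : r z < 3
    · rcases S.low z hz with h1 | h1 | h1 | h1 | h1 | h1 | h1
      · exact .inl h1
      · exact .inr (.inl ⟨0, h1⟩)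
      · exact .inr (.inl ⟨1, h1⟩)
      · exact .inr (.inl ⟨2, h1⟩)
      · exact .inr (.inr (.inr ⟨m1, m2, m12, ⟨h1 ▸ hsy _ _ F.i10, by rw [h1, S.rm1, S.rn0]; omega⟩,
          ⟨h1 ▸ hsy _ _ F.i20, by rw [h1, S.rm2, S.rn0]; omega⟩⟩))
      · exact .inr (.inr (.inr ⟨m0, m2, m02, ⟨h1 ▸ hsy _ _ F.i01, by rw [h1, S.rm0, S.rn1]; omega⟩,
          ⟨h1 ▸ hsy _ _ F.i21, by rw [h1, S.rm2, S.rn1]; omega⟩⟩))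
      · exact .inr (.inr (.inr ⟨m0, m1, m01, ⟨h1 ▸ hsy _ _ F.i02, by rw [h1, S.rm0, S.rn2]; omega⟩,
          ⟨h1 ▸ hsy _ _ F.i12, by rw [h1, S.rm1, S.rn2]; omega⟩⟩))
    · rcases N z (by omega) with h1 | h1
      · exact .inr (.inr (.inr h1))
      · exact .inr (.inr (.inl ⟨by omega, h1⟩))

theorem Base.card (p : Pl I s) {r : E → ℕ} {l : E} {m : Fin 3 → E} {T : Set E}
    (B : Base I s r l m T) (hE : ℵ₀ < #E) : #T = #E := by
  apply le_antisymm (Cardinal.mk_set_le T)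
  have h1 : #E ≤ max #((({l} : Set E) ∪ Set.range m) ∪ T : Set E) ℵ₀ := by
    apply card_le p (r := r)
    intro z hz
    rcases B.out z with h1 | ⟨i, h1⟩ | h1 | h1
    · exact absurd (.inl (.inl h1)) hz
    · exact absurd (.inl (.inr ⟨i, h1.symm⟩)) hz
    · exact absurd (.inr h1) hz
    · exact h1
  by_contra hlt
  have h2 : #T < #E := not_le.mp hlt
  have h3 : #(({l} : Set E) ∪ Set.range m : Set E) < ℵ₀ := by
    rw [Cardinal.lt_aleph0_iff_set_finite]
    exact (Set.finite_singleton l).union (Set.finite_range m)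
  have h4 : #((({l} : Set E) ∪ Set.range m) ∪ T : Set E) < #E :=
    (Cardinal.mk_union_le _ _).trans_lt (Cardinal.add_lt_of_lt hE.le (h3.trans hE) h2)
  exact absurd h1 (not_le.mpr (max_lt h4 hE))

theorem Base.pi (p : Pl I s) (p' : Pl I' s') {r : E → ℕ} {l : E} {m : Fin 3 → E} {T : Set E}
    (B : Base I s r l m T) {r' : E' → ℕ} {l' : E'} {m' : Fin 3 → E'} {T' : Set E'}
    (B' : Base I' s' r' l' m' T') (e : T ≃ T') :
    PI I s r I' s' r' {u | (u.1 = l ∧ u.2 = l') ∨ (∃ i, u.1 = m i ∧ u.2 = m' i) ∨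
      ∃ t : T, u.1 = t ∧ u.2 = e t} := by
  have ss : ∀ x y, s x → s y → ¬ I x y := fun x y h1 h2 h3 => (p.sort _ _ h3).1 h1 h2
  have ss' : ∀ x y, s' x → s' y → ¬ I' x y := fun x y h1 h2 h3 => (p'.sort _ _ h3).1 h1 h2
  have nn : ∀ x y, ¬ s x → ¬ s y → ¬ I x y := fun x y h1 h2 h3 => h1 ((p.sort _ _ h3).2 h2)
  have nn' : ∀ x y, ¬ s' x → ¬ s' y → ¬ I' x y := fun x y h1 h2 h3 => h1 ((p'.sort _ _ h3).2 h2)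
  refine ⟨?_, ?_, ?_, ?_, ?_⟩
  · rintro x y c d (⟨rfl, rfl⟩ | ⟨i, rfl, rfl⟩ | ⟨t, rfl, rfl⟩)
      (⟨h1, h2⟩ | ⟨j, h1, h2⟩ | ⟨t', h1, h2⟩) <;> dsimp only at h1 h2 <;> rw [h1, h2]
    · simp
    · exact iff_of_false (fun h => B.sl (h ▸ B.sm j)) (fun h => B'.sl (h ▸ B'.sm j))
    · exact iff_of_false (fun h => B.sl (h ▸ B.st _ t'.2)) (fun h => B'.sl (h ▸ B'.st _ (e t').2))
    · exact iff_of_false (fun h => B.sl (h ▸ B.sm i)) (fun h => B'.sl (h ▸ B'.sm i))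
    · constructor
      · intro h; rw [B.mi i j h]
      · intro h; rw [B'.mi i j h]
    · exact iff_of_false (fun h => B.mt i (h ▸ t'.2)) (fun h => B'.mt i (h ▸ (e t').2))
    · exact iff_of_false (fun h => B.sl (h ▸ B.st _ t.2)) (fun h => B'.sl (h ▸ B'.st _ (e t).2))
    · exact iff_of_false (fun h => B.mt j (h ▸ t.2)) (fun h => B'.mt j (h ▸ (e t).2))
    · rw [Subtype.coe_inj, Subtype.coe_inj, e.apply_eq_iff_eq]
  · rintro x y c d (⟨rfl, rfl⟩ | ⟨i, rfl, rfl⟩ | ⟨t, rfl, rfl⟩)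
      (⟨h1, h2⟩ | ⟨j, h1, h2⟩ | ⟨t', h1, h2⟩) <;> dsimp only at h1 h2 <;> rw [h1, h2]
    · exact iff_of_false (nn _ _ B.sl B.sl) (nn' _ _ B'.sl B'.sl)
    · exact iff_of_false (fun h => B.ml j (p.symm _ _ h)) (fun h => B'.ml j (p'.symm _ _ h))
    · exact iff_of_true (p.symm _ _ (B.tl _ t'.2)) (p'.symm _ _ (B'.tl _ (e t').2))
    · exact iff_of_false (B.ml i) (B'.ml i)
    · exact iff_of_false (ss _ _ (B.sm _) (B.sm _)) (ss' _ _ (B'.sm _) (B'.sm _))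
    · exact iff_of_false (ss _ _ (B.sm _) (B.st _ t'.2)) (ss' _ _ (B'.sm _) (B'.st _ (e t').2))
    · exact iff_of_true (B.tl _ t.2) (B'.tl _ (e t).2)
    · exact iff_of_false (ss _ _ (B.st _ t.2) (B.sm _)) (ss' _ _ (B'.st _ (e t).2) (B'.sm _))
    · exact iff_of_false (ss _ _ (B.st _ t.2) (B.st _ t'.2))
        (ss' _ _ (B'.st _ (e t).2) (B'.st _ (e t').2))
  · rintro x c (⟨rfl, rfl⟩ | ⟨i, rfl, rfl⟩ | ⟨t, rfl, rfl⟩)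
    · exact iff_of_false B.sl B'.sl
    · exact iff_of_true (B.sm i) (B'.sm i)
    · exact iff_of_true (B.st _ t.2) (B'.st _ (e t).2)
  · rintro x c (⟨rfl, rfl⟩ | ⟨i, rfl, rfl⟩ | ⟨t, rfl, rfl⟩) y hy
    · exact absurd hy (B.ol y)
    · exact absurd hy (B.om i y)
    · exact ⟨l', .inl ⟨B.ot _ t.2 y hy, rfl⟩⟩
  · rintro x c (⟨rfl, rfl⟩ | ⟨i, rfl, rfl⟩ | ⟨t, rfl, rfl⟩) y hy
    · exact absurd hy (B'.ol y)
    · exact absurd hy (B'.om i y)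
    · exact ⟨l, .inl ⟨rfl, B'.ot _ (e t).2 y hy⟩⟩

theorem main_iso (p : Pl I s) (p' : Pl I' s') {r : E → ℕ} {r' : E' → ℕ} (hr : HF I r)
    (hr' : HF I' r') (hE : ℵ₀ < #E) (hc : #E = #E') :
    ∃ f : E ≃ E', (∀ x, s x ↔ s' (f x)) ∧ ∀ x y, I x y ↔ I' (f x) (f y) := by
  obtain ⟨r, l, m, T, hr, B⟩ := exists_base p hr
  obtain ⟨r', l', m', T', hr', B'⟩ := exists_base p' hr'
  have h1 : #T = #T' := by
    rw [B.card p hE, B'.card p' (hc ▸ hE), hc]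
  obtain ⟨e⟩ := Cardinal.eq.1 h1
  refine (B.pi p p' B' e).iso p p' hr hr' ?_ ?_
  · intro x
    rcases B.out x with h1 | ⟨i, h1⟩ | h1 | h1
    · exact .inl ⟨l', .inl ⟨h1, rfl⟩⟩
    · exact .inl ⟨m' i, .inr (.inl ⟨i, h1, rfl⟩)⟩
    · exact .inl ⟨e ⟨x, h1⟩, .inr (.inr ⟨⟨x, h1⟩, rfl, rfl⟩)⟩
    · exact .inr h1
  · intro x
    rcases B'.out x with h1 | ⟨i, h1⟩ | h1 | h1
    · exact .inl ⟨l, .inl ⟨rfl, h1⟩⟩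
    · exact .inl ⟨m i, .inr (.inl ⟨i, rfl, h1⟩)⟩
    · refine .inl ⟨e.symm ⟨x, h1⟩, .inr (.inr ⟨e.symm ⟨x, h1⟩, rfl, ?_⟩)⟩
      simp
    · exact .inr h1

section Plane

open Configuration

theorem exists_off {P L : Type u} [Membership P L] [ProjectivePlane P L] (l l' : L) :
    ∃ p : P, p ∉ l ∧ p ∉ l' := by
  classical
  have eqe : ∀ (x y : P) (k k' : L), x ≠ y → x ∈ k → y ∈ k → x ∈ k' → y ∈ k' → k = k' :=
    fun x y k k' hne h1 h2 h3 h4 => (Nondegenerate.eq_or_eq h1 h2 h3 h4).resolve_left hne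
  have pt : ∀ k k' : L, k ≠ k' → ∃ p : P, p ∈ k ∧ p ∈ k' := fun k k' h =>
    ⟨HasPoints.mkPoint h, HasPoints.mkPoint_ax h⟩
  have ln : ∀ p q : P, p ≠ q → ∃ k : L, p ∈ k ∧ q ∈ k := fun p q h =>
    ⟨HasLines.mkLine h, HasLines.mkLine_ax h⟩
  obtain ⟨p₁, p₂, p₃, l₁, l₂, l₃, h12, h13, h21, h22, h23, h31, h32, h33⟩ :=
    ProjectivePlane.exists_config (P := P) (L := L)
  have l12 : l₁ ≠ l₂ := fun e => h21 (e ▸ h22)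
  have l23 : l₂ ≠ l₃ := fun e => h33 (e ▸ h32)
  obtain ⟨b, hb1, hb2⟩ := pt l₁ l₂ l12
  have bp2 : b ≠ p₂ := fun e => h21 (e ▸ hb1)
  have bp3 : b ≠ p₃ := fun e => h31 (e ▸ hb1)
  have p23 : p₂ ≠ p₃ := fun e => h33 (e ▸ h23)
  have stepA : ∀ k : L, k ≠ l₂ → ∃ q : P, q ∉ k ∧ q ∉ l₂ := by
    intro k hk
    by_contra hh
    push Not at hh
    have hh' : ∀ q : P, q ∉ l₂ → q ∈ k := fun q hq => by
      by_contra h1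
      exact hq (hh q h1)
    have key : ∀ t : P, t ∈ l₂ → t ≠ p₂ → t ∈ k := by
      intro t ht htp
      obtain ⟨j, hj1, hj2⟩ := ln p₁ t (fun e => h12 (e ▸ ht))
      obtain ⟨c, hc1, hc2⟩ := pt j l₃ (fun e => h13 (e ▸ hj1))
      have hc : c ∉ l₂ := by
        intro hc
        have hcp : c = p₂ := by
          by_contra hne
          exact l23 (eqe c p₂ _ _ hne hc h22 hc2 h23)
        subst hcp
        exact h12 (eqe t c j l₂ htp hj2 hc1 ht h22 ▸ hj1)
      have h1 : p₁ ≠ c := fun e => h13 (e ▸ hc2)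
      exact eqe p₁ c j k h1 hj1 hc1 (hh' _ h12) (hh' _ hc) ▸ hj2
    exact hk (eqe b p₃ _ _ bp3 (key b hb2 bp2) (key p₃ h32 p23.symm) hb2 h32)
  have thr : ∀ (k : L) (x y z : P), x ∈ k → y ∈ k → z ∈ k → x ≠ y → x ≠ z → y ≠ z →
      ∀ a c : P, ∃ d : P, d ∈ k ∧ d ≠ a ∧ d ≠ c := by
    intro k x y z hx hy hz xy xz yz a c
    by_cases h1 : x ≠ a ∧ x ≠ c
    · exact ⟨x, hx, h1⟩
    by_cases h2 : y ≠ a ∧ y ≠ c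
    · exact ⟨y, hy, h2⟩
    · refine ⟨z, hz, ?_⟩
      constructor <;> rintro rfl <;> grind
  have stepB : ∀ (k : L) (a c : P), ∃ d : P, d ∈ k ∧ d ≠ a ∧ d ≠ c := by
    intro k
    by_cases hk : k = l₂
    · exact thr k b p₂ p₃ (hk ▸ hb2) (hk ▸ h22) (hk ▸ h32) bp2 bp3 p23
    · obtain ⟨o, ho1, ho2⟩ := stepA k hk
      have proj : ∀ t : P, t ∈ l₂ → ∃ (t' : P) (j : L), t' ∈ k ∧ t' ∈ j ∧ t ∈ j ∧ o ∈ j := by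
        intro t ht
        obtain ⟨j, hj1, hj2⟩ := ln o t (fun e => ho2 (e ▸ ht))
        obtain ⟨t', h1, h2⟩ := pt j k (fun e => ho1 (e ▸ hj1))
        exact ⟨t', j, h2, h1, hj2, hj1⟩
      have inj : ∀ (t w t' w' : P) (j j' : L), t ∈ l₂ → w ∈ l₂ → t' ∈ k → t' ∈ j → t ∈ j → o ∈ j →
          w' ∈ j' → w ∈ j' → o ∈ j' → t ≠ w → t' ≠ w' := by
        intro t w t' w' j j' ht hw h1 h2 h3 h4 h5 h6 h7 hne e
        subst e
        have hj : j = j' := eqe o t' j j' (fun e => ho1 (e ▸ h1)) h4 h2 h7 h5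
        subst hj
        exact ho2 (eqe t w j l₂ hne h3 h6 ht hw ▸ h4)
      obtain ⟨x, j1, x1, x2, x3, x4⟩ := proj b hb2
      obtain ⟨y, j2, y1, y2, y3, y4⟩ := proj p₂ h22
      obtain ⟨z, j3, z1, z2, z3, z4⟩ := proj p₃ h32
      exact thr k x y z x1 y1 z1
        (inj b p₂ x y j1 j2 hb2 h22 x1 x2 x3 x4 y2 y3 y4 bp2)
        (inj b p₃ x z j1 j3 hb2 h32 x1 x2 x3 x4 z2 z3 z4 bp3)
        (inj p₂ p₃ y z j2 j3 h22 h32 y1 y2 y3 y4 z2 z3 z4 p23)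
  by_cases hl : l = l'
  · subst hl
    obtain ⟨p, hp⟩ := Nondegenerate.exists_point (P := P) l
    exact ⟨p, hp, hp⟩
  · obtain ⟨i, hi1, hi2⟩ := pt l l' hl
    obtain ⟨a, ha, hai, -⟩ := stepB l i i
    obtain ⟨c, hc, hci, -⟩ := stepB l' i i
    have ha' : a ∉ l' := fun h1 => hl (eqe a i _ _ hai ha hi1 h1 hi2)
    have hc' : c ∉ l := fun h1 => hl (eqe c i _ _ hci h1 hi1 hc hi2)
    obtain ⟨j, hj1, hj2⟩ := ln a c (fun e => ha' (e ▸ hc))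
    obtain ⟨d, hd, hda, hdc⟩ := stepB j a c
    refine ⟨d, fun h1 => ?_, fun h1 => ?_⟩
    · exact hc' (eqe d a j l hda hd hj1 h1 ha ▸ hj2)
    · exact ha' (eqe d c j l' hdc hd hj2 h1 hc ▸ hj1)

theorem plane_pl (P L : Type u) [Membership P L] [ProjectivePlane P L] :
    Pl (HFIncid (P := P) (L := L)) (fun x => x.isLeft = true) := by
  refine ⟨?_, ?_, ?_, ?_, ?_, ?_, ?_⟩
  · rintro (x | x) (y | y) h <;> first | exact h | exact h.elim
  · rintro (x | x) (y | y) h <;> first | exact h.elim | simp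
  · rintro (x | x) (y | y) h1 h2
    · have h : x ≠ y := fun e => h1 (e ▸ rfl)
      exact ⟨.inr (HasLines.mkLine h), HasLines.mkLine_ax h⟩
    · simp at h2
    · simp at h2
    · have h : x ≠ y := fun e => h1 (e ▸ rfl)
      exact ⟨.inl (HasPoints.mkPoint h), HasPoints.mkPoint_ax h⟩
  · rintro (x | x) (y | y) (a | a) (b | b) h1 h2 h3 h4 <;>
      first | exact h1.elim | exact h2.elim | exact h3.elim | exact h4.elim | skip
    · rcases Nondegenerate.eq_or_eq (P := P) (L := L) h1 h2 h3 h4 with h | h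
      · exact .inl (h ▸ rfl)
      · exact .inr (h ▸ rfl)
    · rcases Nondegenerate.eq_or_eq (P := P) (L := L) h1 h3 h2 h4 with h | h
      · exact .inr (h ▸ rfl)
      · exact .inl (h ▸ rfl)
  · rintro (l | l) (l' | l') h1 h2
    · simp at h1
    · simp at h1
    · simp at h2
    · obtain ⟨p, hp1, hp2⟩ := exists_off (P := P) l l'
      exact ⟨.inl p, rfl, hp1, hp2⟩
  · obtain ⟨p₁, p₂, p₃, l₁, l₂, l₃, h⟩ := ProjectivePlane.exists_config (P := P) (L := L)
    exact ⟨.inr l₁, by simp⟩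
  · rintro (p | p) hp
    · obtain ⟨l, hl⟩ := Nondegenerate.exists_line (P := P) (L := L) p
      obtain ⟨q, hq, -⟩ := exists_off (P := P) l l
      obtain ⟨p₁, p₂, p₃, l₁, l₂, l₃, h⟩ := ProjectivePlane.exists_config (P := P) (L := L)
      have hex : ∃ q : P, p ≠ q := by
        by_cases h1 : p = p₂
        · exact ⟨p₃, fun e => h.2.2.2.2.2.2.2 (e ▸ h1 ▸ h.2.2.2.2.1)⟩
        · exact ⟨p₂, h1⟩
      obtain ⟨q, hq⟩ := hex
      exact ⟨.inr (HasLines.mkLine hq), by simp, (HasLines.mkLine_ax hq).1⟩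
    · simp at hp

theorem exists_rank {P L : Type u} [Membership P L] (h : HasWFHFOrder P L)
    (hsy : ∀ x y : P ⊕ L, HFIncid x y → HFIncid y x) (hirr : ∀ x : P ⊕ L, ¬ HFIncid x x) :
    ∃ r : P ⊕ L → ℕ, HF HFIncid r := by
  classical
  obtain ⟨r, hwo, h⟩ := h
  choose a b hab using h
  have hwf : WellFounded r := hwo.wf
  let F : (x : P ⊕ L) → ((y : P ⊕ L) → r y x → ℕ) → ℕ := fun x ih =>
    max (if h : r (a x) x then ih (a x) h else 0) (if h : r (b x) x then ih (b x) h else 0) + 1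
  let lev : P ⊕ L → ℕ := hwf.fix F
  have hlev : ∀ x, lev x = max (if r (a x) x then lev (a x) else 0)
      (if r (b x) x then lev (b x) else 0) + 1 := by
    intro x
    have := hwf.fix_eq F x
    simpa [F, lev] using this
  clear_value lev
  have key : ∀ x y, HFIncid y x → r y x → lev y < lev x := by
    intro x y hi hr
    rw [hlev x]
    rcases hab x y hr hi with h1 | h1
    · rw [← h1, if_pos hr]; omega
    · rw [← h1, if_pos hr]; omega
  have tri : ∀ x y, HFIncid x y → r x y ∨ r y x := by
    intro x y hi
    rcases trichotomous_of r x y with h1 | h1 | h1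
    · exact .inl h1
    · exact absurd hi (h1 ▸ hirr x)
    · exact .inr h1
  refine ⟨lev, ?_, ?_⟩
  · intro x y hi
    rcases tri x y hi with h1 | h1
    · have := key y x hi h1; omega
    · have := key x y (hsy _ _ hi) h1; omega
  · have out : ∀ x y, O HFIncid lev x y → y = a x ∨ y = b x := by
      intro x y hy
      rcases tri x y hy.1 with h1 | h1
      · have := key y x hy.1 h1
        have := hy.2
        omega
      · exact hab x y h1 (hsy _ _ hy.1)
    intro x c d e hc hd he
    have h1 := out x c hc
    have h2 := out x d hd
    have h3 := out x e he
    clear * - h1 h2 h3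
    grind

theorem final (κ : Cardinal.{u}) (hκ : Cardinal.aleph0.{u} < κ)
    (P₁ L₁ P₂ L₂ : Type u) [Membership P₁ L₁] [Membership P₂ L₂]
    [Configuration.ProjectivePlane P₁ L₁] [Configuration.ProjectivePlane P₂ L₂]
    (h₁ : HasWFHFOrder P₁ L₁) (h₂ : HasWFHFOrder P₂ L₂)
    (hc₁ : #P₁ + #L₁ = κ) (hc₂ : #P₂ + #L₂ = κ) :
    ∃ (f : P₁ ≃ P₂) (g : L₁ ≃ L₂), ∀ (p : P₁) (l : L₁), p ∈ l ↔ f p ∈ g l := by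
  have irr : ∀ (P L : Type u) [Membership P L] (x : P ⊕ L), ¬ HFIncid x x := by
    rintro P L _ (x | x) h <;> exact h
  have p₁ := plane_pl P₁ L₁
  have p₂ := plane_pl P₂ L₂
  obtain ⟨r₁, hr₁⟩ := exists_rank h₁ p₁.symm (irr _ _)
  obtain ⟨r₂, hr₂⟩ := exists_rank h₂ p₂.symm (irr _ _)
  have e₁ : #(P₁ ⊕ L₁) = κ := by rw [← hc₁]; simp
  have e₂ : #(P₂ ⊕ L₂) = κ := by rw [← hc₂]; simp
  obtain ⟨φ, hs, hi⟩ := main_iso p₁ p₂ hr₁ hr₂ (e₁ ▸ hκ) (e₁.trans e₂.symm)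
  have fe : ∀ p : P₁, ∃ q : P₂, φ (.inl p) = .inl q := by
    intro p
    have h1 := (hs (.inl p)).1 rfl
    cases h : φ (.inl p) with
    | inl q => exact ⟨q, rfl⟩
    | inr q => rw [h] at h1; simp at h1
  have ge : ∀ l : L₁, ∃ q : L₂, φ (.inr l) = .inr q := by
    intro p
    have h1 := (hs (.inr p)).2
    cases h : φ (.inr p) with
    | inr q => exact ⟨q, rfl⟩
    | inl q => rw [h] at h1; simp at h1
  choose f hf using fe
  choose g hg using ge
  have fb : Function.Bijective f := by
    constructor
    · intro x y hxy
      have : φ (.inl x) = φ (.inl y) := by rw [hf, hf, hxy]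
      exact Sum.inl_injective (φ.injective this)
    · intro q
      obtain ⟨x, hx⟩ := φ.surjective (.inl q)
      cases x with
      | inl p => exact ⟨p, Sum.inl_injective ((hf p).symm.trans hx)⟩
      | inr l => rw [hg] at hx; cases hx
  have gb : Function.Bijective g := by
    constructor
    · intro x y hxy
      have : φ (.inr x) = φ (.inr y) := by rw [hg, hg, hxy]
      exact Sum.inr_injective (φ.injective this)
    · intro q
      obtain ⟨x, hx⟩ := φ.surjective (.inr q)
      cases x with
      | inr p => exact ⟨p, Sum.inr_injective ((hg p).symm.trans hx)⟩
      | inl l => rw [hf] at hx; cases hx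
  refine ⟨Equiv.ofBijective f fb, Equiv.ofBijective g gb, fun p l => ?_⟩
  have := hi (.inl p) (.inr l)
  rw [hf, hg] at this
  exact this

end Plane

end HFP

/-- Theorem 5.28 / Corollary 5.29: the class of projective planes admitting
a well-founded HF-order is uncountably categorical: any two such planes of the same
uncountable cardinality `κ` (measured as `#points + #lines`) are isomorphic as incidence
structures. -/
theorem statement19 (κ : Cardinal.{u}) (hκ : Cardinal.aleph0.{u} < κ)
    (P₁ L₁ P₂ L₂ : Type u) [Membership P₁ L₁] [Membership P₂ L₂]
    [Configuration.ProjectivePlane P₁ L₁] [Configuration.ProjectivePlane P₂ L₂]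
    (h₁ : HasWFHFOrder P₁ L₁) (h₂ : HasWFHFOrder P₂ L₂)
    (hc₁ : #P₁ + #L₁ = κ) (hc₂ : #P₂ + #L₂ = κ) :
    ∃ (f : P₁ ≃ P₂) (g : L₁ ≃ L₂), ∀ (p : P₁) (l : L₁), p ∈ l ↔ f p ∈ g l := by
  exact HFP.final κ hκ P₁ L₁ P₂ L₂ h₁ h₂ hc₁ hc₂
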